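/- Let G be an ordered graph containing two bordered cycles of length 4 such that the inner border of the first equals the outer border of the second. Then G contains the ordered 6-cycle C^2_6. -/

import Mathlib

/-- `HasBorderedCycleWith G l outer inner` says that the ordered graph `G` (a simple graph on a
linearly ordered vertex set) contains a bordered cycle of length `2 * l` whose outer border is
the pair `outer` and whose inner border is the pair `inner`.  That is, there are vertices
`u 0 < u 1 < ⋯ < u (l-1) < v 0 < v 1 < ⋯ < v (l-1)` and a cycle of length `2 * l` in `G` on
these `2 * l` vertices, every edge of which joins some `u i` to some `v j`, such that both the
pair `{u 0, v (l-1)}` (the outer border) and the pair `{u (l-1), v 0}` (the inner border) are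
edges of the cycle; moreover `outer = {u 0, v (l-1)}` and `inner = {u (l-1), v 0}`.
Since every edge of the cycle joins a `u i` to a `v j`, the cycle alternates between the `u`'s
and the `v`'s, so it can be encoded by a pair of permutations `a b` of `Fin l`: the cycle
visits `u (a 0), v (b 0), u (a 1), v (b 1), …, u (a (l-1)), v (b (l-1))` and returns to
`u (a 0)`.  Its edges are thus the pairs `{u (a s), v (b s)}` and `{u (a (s+1)), v (b s)}`
(with `s + 1` taken cyclically in `Fin l`). -/
def HasBorderedCycleWith {V : Type*} [LinearOrder V] (G : SimpleGraph V) (l : ℕ)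
    (outer inner : Sym2 V) : Prop :=
  ∃ m : ℕ, l = m + 2 ∧ ∃ (u v : Fin (m + 2) → V) (a b : Equiv.Perm (Fin (m + 2))),
    StrictMono u ∧ StrictMono v ∧ u (Fin.last (m + 1)) < v 0 ∧
    (∀ s, G.Adj (u (a s)) (v (b s))) ∧
    (∀ s, G.Adj (u (a (s + 1))) (v (b s))) ∧
    (∃ s, (a s = 0 ∧ b s = Fin.last (m + 1)) ∨ (a (s + 1) = 0 ∧ b s = Fin.last (m + 1))) ∧
    (∃ s, (a s = Fin.last (m + 1) ∧ b s = 0) ∨ (a (s + 1) = Fin.last (m + 1) ∧ b s = 0)) ∧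
    outer = s(u 0, v (Fin.last (m + 1))) ∧ inner = s(u (Fin.last (m + 1)), v 0)

/-- The ordered graph `G` contains a bordered cycle of length `2 * l`. -/
def HasBorderedCycle {V : Type*} [LinearOrder V] (G : SimpleGraph V) (l : ℕ) : Prop :=
  ∃ outer inner, HasBorderedCycleWith G l outer inner

/-- The ordered graph `G` contains the ordered 6-cycle `C⁶₁`: vertices `w 0 < w 1 < ⋯ < w 5`
with edges `{w 0, w 4}, {w 4, w 1}, {w 1, w 3}, {w 3, w 2}, {w 2, w 5}, {w 5, w 0}`. -/
def HasC6one {V : Type*} [LinearOrder V] (G : SimpleGraph V) : Prop :=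
  ∃ w : Fin 6 → V, StrictMono w ∧
    G.Adj (w 0) (w 4) ∧ G.Adj (w 4) (w 1) ∧ G.Adj (w 1) (w 3) ∧
    G.Adj (w 3) (w 2) ∧ G.Adj (w 2) (w 5) ∧ G.Adj (w 5) (w 0)

/-- The ordered graph `G` contains the ordered 6-cycle `C⁶₂`: vertices `w 0 < w 1 < ⋯ < w 5`
with edges `{w 0, w 4}, {w 4, w 2}, {w 2, w 3}, {w 3, w 1}, {w 1, w 5}, {w 5, w 0}`. -/
def HasC6two {V : Type*} [LinearOrder V] (G : SimpleGraph V) : Prop :=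
  ∃ w : Fin 6 → V, StrictMono w ∧
    G.Adj (w 0) (w 4) ∧ G.Adj (w 4) (w 2) ∧ G.Adj (w 2) (w 3) ∧
    G.Adj (w 3) (w 1) ∧ G.Adj (w 1) (w 5) ∧ G.Adj (w 5) (w 0)

/-- The ordered graph `G` contains the ordered 6-cycle `C⁶₃`: vertices `w 0 < w 1 < ⋯ < w 5`
with edges `{w 0, w 5}, {w 5, w 1}, {w 1, w 4}, {w 4, w 2}, {w 2, w 3}, {w 3, w 0}`. -/
def HasC6three {V : Type*} [LinearOrder V] (G : SimpleGraph V) : Prop :=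
  ∃ w : Fin 6 → V, StrictMono w ∧
    G.Adj (w 0) (w 5) ∧ G.Adj (w 5) (w 1) ∧ G.Adj (w 1) (w 4) ∧
    G.Adj (w 4) (w 2) ∧ G.Adj (w 2) (w 3) ∧ G.Adj (w 3) (w 0)

/-- The ordered graph `G` contains the ordered 6-cycle `C⁶ᵁ`: vertices `w 0 < w 1 < ⋯ < w 5`
with edges `{w 0, w 4}, {w 4, w 2}, {w 2, w 5}, {w 5, w 1}, {w 1, w 3}, {w 3, w 0}`. -/
def HasC6U {V : Type*} [LinearOrder V] (G : SimpleGraph V) : Prop :=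
  ∃ w : Fin 6 → V, StrictMono w ∧
    G.Adj (w 0) (w 4) ∧ G.Adj (w 4) (w 2) ∧ G.Adj (w 2) (w 5) ∧
    G.Adj (w 5) (w 1) ∧ G.Adj (w 1) (w 3) ∧ G.Adj (w 3) (w 0)

/-- The ordered graph `G` contains the ordered 6-cycle `C⁶ᴵ`: vertices `w 0 < w 1 < ⋯ < w 5`
with edges `{w 0, w 4}, {w 4, w 1}, {w 1, w 5}, {w 5, w 2}, {w 2, w 3}, {w 3, w 0}`. -/
def HasC6I {V : Type*} [LinearOrder V] (G : SimpleGraph V) : Prop :=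
  ∃ w : Fin 6 → V, StrictMono w ∧
    G.Adj (w 0) (w 4) ∧ G.Adj (w 4) (w 1) ∧ G.Adj (w 1) (w 5) ∧
    G.Adj (w 5) (w 2) ∧ G.Adj (w 2) (w 3) ∧ G.Adj (w 3) (w 0)

/-- The ordered graph `G` contains the ordered 6-cycle `C⁶ᴼ`: vertices `w 0 < w 1 < ⋯ < w 5`
with edges `{w 0, w 3}, {w 3, w 1}, {w 1, w 4}, {w 4, w 2}, {w 2, w 5}, {w 5, w 0}`. -/
def HasC6O {V : Type*} [LinearOrder V] (G : SimpleGraph V) : Prop :=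
  ∃ w : Fin 6 → V, StrictMono w ∧
    G.Adj (w 0) (w 3) ∧ G.Adj (w 3) (w 1) ∧ G.Adj (w 1) (w 4) ∧
    G.Adj (w 4) (w 2) ∧ G.Adj (w 2) (w 5) ∧ G.Adj (w 5) (w 0)

/-- A bordered cycle of length `4` is a complete bipartite graph between the two smaller and the
two larger of its vertices. -/
theorem HasBorderedCycleWith.exists_of_two {V : Type*} [LinearOrder V] {G : SimpleGraph V}
    {outer inner : Sym2 V} (h : HasBorderedCycleWith G 2 outer inner) :
    ∃ p q r t : V, p < q ∧ q < r ∧ r < t ∧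
      G.Adj p r ∧ G.Adj p t ∧ G.Adj q r ∧ G.Adj q t ∧
      outer = s(p, t) ∧ inner = s(q, r) := by
  obtain ⟨m, hm, u, v, a, b, hu, hv, huv, hadj, hadj', -, -, houter, hinner⟩ := h
  obtain rfl : m = 0 := by omega
  have hall : ∀ i j, G.Adj (u i) (v j) := by
    intro i j
    obtain ⟨s, rfl⟩ := b.surjective j
    obtain ⟨t, rfl⟩ := a.surjective i
    have hts : ∀ t s : Fin 2, t = s ∨ t = s + 1 := by decide
    rcases hts t s with rfl | rfl
    · exact hadj _
    · exact hadj' _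
  exact ⟨u 0, u 1, v 0, v 1, hu (by decide), huv, hv (by decide), hall _ _, hall _ _,
    hall _ _, hall _ _, houter, hinner⟩

/-- If the ordered graph `G` contains two bordered cycles of length `4` such that the inner
border of the first equals the outer border of the second, then `G` contains the ordered
6-cycle `C⁶₂`. -/
theorem two_bordered_squares_give_C6two {V : Type*} [LinearOrder V] (G : SimpleGraph V)
    (e f g : Sym2 V)
    (h1 : HasBorderedCycleWith G 2 e f) (h2 : HasBorderedCycleWith G 2 f g) :
    HasC6two G := by
  obtain ⟨p, q, r, t, hpq, hqr, hrt, hpr, hpt, -, hqt, -, rfl⟩ := h1.exists_of_two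
  obtain ⟨q', x, y, r', hqx, hxy, hyr, hqy, -, hxy', hxr, hf, -⟩ := h2.exists_of_two
  obtain ⟨rfl, rfl⟩ : q = q' ∧ r = r' := by
    rcases Sym2.eq_iff.mp hf with h | ⟨rfl, rfl⟩
    · exact h
    · order
  refine ⟨![p, q, x, y, r, t], Fin.strictMono_iff_lt_succ.mpr ?_,
    hpr, hxr.symm, hxy', hqy.symm, hqt, hpt.symm⟩
  intro i
  fin_cases i
  exacts [hpq, hqx, hxy, hyr, hrt]
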